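/- Let G be a 4-connected graph on seven vertices with maximum degree at most 5 and with at least two vertices of degree 5. Then every split of G contains W₆ as a minor. In particular, every split of any of the seven graphs C²₇ + e, DW₅, K^{3,0}_{4,3}, K^{3,1}_{4,3}, K^{4,0}_{4,3}, Γ₁, K^{4,1}_{4,3} contains W₆ as a minor. -/

import Mathlib

open SimpleGraph

/-- `H` is a minor of `G`: there is a family of nonempty, pairwise disjoint,
connected branch sets in `G`, one for each vertex of `H`, such that adjacent
vertices of `H` have branch sets joined by an edge of `G`. -/
def SimpleGraph.IsMinorOf {W V : Type*} (H : SimpleGraph W) (G : SimpleGraph V) : Prop :=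
  ∃ φ : W → Set V,
    (∀ w, (φ w).Nonempty) ∧
    (∀ w, (G.induce (φ w)).Connected) ∧
    (Pairwise fun w₁ w₂ => Disjoint (φ w₁) (φ w₂)) ∧
    (∀ ⦃w₁ w₂⦄, H.Adj w₁ w₂ → ∃ a ∈ φ w₁, ∃ b ∈ φ w₂, G.Adj a b)

/-- The wheel `Wₙ`: a hub (`none`) joined to every vertex of a cycle of length `n`. -/
def wheel (n : ℕ) : SimpleGraph (Option (ZMod n)) :=
  SimpleGraph.fromRel fun a b =>
    (a = none ∧ b ≠ none) ∨ (∃ i j : ZMod n, a = some i ∧ b = some j ∧ j = i + 1)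

/-- The square `C²ₙ` of the `n`-cycle. -/
def cycleSq (n : ℕ) : SimpleGraph (ZMod n) :=
  SimpleGraph.fromRel fun i j => j = i + 1 ∨ j = i + 2

/-- A graph is 4-connected if it has at least five vertices and deleting any set
of at most three vertices leaves it connected. -/
def FourConnected {V : Type*} (G : SimpleGraph V) : Prop :=
  5 ≤ Nat.card V ∧ ∀ S : Set V, S.ncard ≤ 3 → (G.induce Sᶜ).Connected

/-- The double wheel `DWₙ`: a cycle of length `n` plus two nonadjacent hubs,
each joined to every vertex of the cycle. -/
def doubleWheel (n : ℕ) : SimpleGraph (ZMod n ⊕ Fin 2) :=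
  SimpleGraph.fromRel fun a b =>
    match a, b with
    | .inl i, .inl j => j = i + 1
    | .inl _, .inr _ => True
    | .inr _, .inl _ => True
    | .inr _, .inr _ => False

/-- `C²₇ + e`: the square of the 7-cycle plus an edge between two (of the)
nonadjacent vertices (all such additions give isomorphic graphs). -/
def cycleSq7PlusE : SimpleGraph (ZMod 7) :=
  SimpleGraph.fromRel fun i j => j = i + 1 ∨ j = i + 2 ∨ (i = 0 ∧ j = 3)

/-- `K^{3,0}_{4,3}`: `K_{4,3}` plus three edges forming a path on the four
vertices of the part of size four. -/
def K43_30 : SimpleGraph (Fin 4 ⊕ Fin 3) :=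
  SimpleGraph.fromRel fun a b =>
    match a, b with
    | .inl _, .inr _ => True
    | .inr _, .inl _ => True
    | .inl i, .inl j => (j : ℕ) = (i : ℕ) + 1
    | .inr _, .inr _ => False

/-- `K^{3,1}_{4,3}`: `K^{3,0}_{4,3}` plus one edge between two vertices of
the part of size three. -/
def K43_31 : SimpleGraph (Fin 4 ⊕ Fin 3) :=
  SimpleGraph.fromRel fun a b =>
    match a, b with
    | .inl _, .inr _ => True
    | .inr _, .inl _ => True
    | .inl i, .inl j => (j : ℕ) = (i : ℕ) + 1
    | .inr i, .inr j => i = 0 ∧ j = 1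

/-- `K^{4,0}_{4,3}`: `K_{4,3}` plus four edges forming a cycle on the four
vertices of the part of size four. -/
def K43_40 : SimpleGraph (Fin 4 ⊕ Fin 3) :=
  SimpleGraph.fromRel fun a b =>
    match a, b with
    | .inl _, .inr _ => True
    | .inr _, .inl _ => True
    | .inl i, .inl j => j = i + 1
    | .inr _, .inr _ => False

/-- `K^{4,1}_{4,3}`: `K^{4,0}_{4,3}` plus one edge between two vertices of
the part of size three. -/
def K43_41 : SimpleGraph (Fin 4 ⊕ Fin 3) :=
  SimpleGraph.fromRel fun a b =>
    match a, b with
    | .inl _, .inr _ => True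
    | .inr _, .inl _ => True
    | .inl i, .inl j => j = i + 1
    | .inr i, .inr j => i = 0 ∧ j = 1

/-- The graph `Γ₁` of Figure 1, with vertices `0 = x`, `1 = y`, `2 = v₂`,
`3 = v₃`, `4 = v₄`, `5 = u`, `6 = w`. -/
def Gamma1 : SimpleGraph (Fin 7) :=
  SimpleGraph.fromEdgeSet
    {s(5, 6), s(5, 2), s(5, 3), s(5, 4), s(6, 2), s(6, 3), s(6, 4),
     s(2, 3), s(3, 4), s(0, 1), s(0, 2), s(0, 4), s(0, 5), s(1, 2), s(1, 4), s(1, 6)}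

/-- The split of a vertex `v` of `G` determined by `X, Y ⊆ N(v)`:
delete `v`, and add two new adjacent vertices (`inr 0` and `inr 1`) joined
to all vertices of `X` and of `Y` respectively. -/
def splitGraph {V : Type*} (G : SimpleGraph V) (v : V) (X Y : Set V) :
    SimpleGraph ({u : V // u ≠ v} ⊕ Fin 2) :=
  SimpleGraph.fromRel fun a b =>
    match a, b with
    | .inl u, .inl u' => G.Adj u u'
    | .inl u, .inr i => (i = 0 ∧ (u : V) ∈ X) ∨ (i = 1 ∧ (u : V) ∈ Y)
    | .inr _, .inl _ => False
    | .inr _, .inr _ => True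

/-- The side conditions on the data of a split of a vertex `v`:
`X, Y ⊆ N(v)`, `X ∪ Y = N(v)` and `|X|, |Y| ≥ 3`. -/
def IsSplitData {V : Type*} (G : SimpleGraph V) (v : V) (X Y : Set V) : Prop :=
  X ⊆ G.neighborSet v ∧ Y ⊆ G.neighborSet v ∧ X ∪ Y = G.neighborSet v ∧
    3 ≤ X.ncard ∧ 3 ≤ Y.ncard

/-- Every split of `G` contains `W₆` as a minor. -/
def AllSplitsHaveW6Minor {V : Type*} (G : SimpleGraph V) : Prop :=
  ∀ (v : V) (X Y : Set V), IsSplitData G v X Y →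
    (wheel 6).IsMinorOf (splitGraph G v X Y)

/-- The number of entries of the edge list `l` incident to the vertex `i`. -/
def edgeDegree (i : ℕ) (l : List (ℕ × ℕ)) : ℕ :=
  l.countP fun e => e.1 == i || e.2 == i

/-- Whether `leaf` holds for every list obtained by adding to the given accumulator a sublist of
the given edges without creating a vertex of degree more than two. -/
def checkAll (leaf : List (ℕ × ℕ) → Bool) : List (ℕ × ℕ) → List (ℕ × ℕ) → Bool
  | [], l => leaf l
  | e :: es, l => checkAll leaf es l &&
      (Nat.blt 2 (edgeDegree e.1 (e :: l)) || Nat.blt 2 (edgeDegree e.2 (e :: l)) ||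
        checkAll leaf es (e :: l))

/-- An edge list on the vertices `0, …, 7` as the bits of an `8 × 8` adjacency matrix. -/
def edgeMask : List (ℕ × ℕ) → ℕ
  | [] => 0
  | e :: l => 2 ^ (8 * e.1 + e.2) ||| (2 ^ (8 * e.2 + e.1) ||| edgeMask l)

/-- Whether there is a path from `x` to `z` whose interior vertices are `n` vertices of the given
list, without repetition. -/
def hamPath (adj : ℕ → ℕ → Bool) (z : ℕ) : ℕ → ℕ → List ℕ → Bool
  | 0, x, _ => adj x z
  | n + 1, x, r => r.any fun y => adj x y && hamPath adj z n y (r.erase y)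

/-- The edges tried as the hub of a `W₆`-minor in a graph on `0, …, 7`. -/
def hubEdges : List (ℕ × ℕ) := [(2, 4), (2, 5), (2, 3), (0, 1), (0, 2), (1, 2)]

theorem hubEdges_spec : ∀ h ∈ hubEdges, h.1 < 8 ∧ h.2 < 8 ∧ h.1 ≠ h.2 ∧
    ((List.range 8).filter fun i => i != h.1 && i != h.2).length = 6 := by
  decide

/-- Whether some edge in `hubEdges` dominates a Hamiltonian cycle on the six other vertices. -/
def hasHubEdge (adj : ℕ → ℕ → Bool) : Bool :=
  hubEdges.any fun h => adj h.1 h.2 &&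
    match (List.range 8).filter fun i => i != h.1 && i != h.2 with
    | [] => false
    | z :: r => (z :: r).all (fun i => adj h.1 i || adj h.2 i) && hamPath adj z 5 z r

/-- Whether the graph on `0, …, 6` contains a cycle of length four. -/
def hasFourCycle (adj : ℕ → ℕ → Bool) : Bool :=
  (List.range 7).any fun a => (List.range 7).any fun b => adj a b &&
    (List.range 7).any fun c => a != c && adj b c &&
      (List.range 7).any fun d => b != d && adj c d && adj d a

/-- Given the list `l` of nonadjacent pairs of a graph on `0, …, 6`, and the list `extra` of further
pairs made nonadjacent by splitting `6` into `6` and `7`: either the graph has a vertex of degree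
six, or it has no vertex of degree five, or the split has a `W₆`-minor, or the complement of the
graph has a cycle of length four. -/
def leafCheck (extra l : List (ℕ × ℕ)) : Bool :=
  (List.range 7).any (fun i => edgeDegree i l == 0) ||
  (List.range 7).all (fun i => edgeDegree i l != 1) ||
  hasHubEdge (fun i j => !(edgeMask (extra ++ l)).testBit (8 * i + j)) ||
  hasFourCycle fun i j => (edgeMask l).testBit (8 * i + j)

/-- The pairs of distinct vertices below `6`. -/
def pairs6 : List (ℕ × ℕ) :=
  [(0, 1), (0, 2), (0, 3), (0, 4), (0, 5), (1, 2), (1, 3), (1, 4), (1, 5), (2, 3), (2, 4), (2, 5),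
    (3, 4), (3, 5), (4, 5)]

/-- The pairs consisting of a vertex below `6` and the vertex `6`. -/
def pairsWith6 : List (ℕ × ℕ) :=
  [(0, 6), (1, 6), (2, 6), (3, 6), (4, 6), (5, 6)]

theorem mem_pairs_iff {i j : ℕ} : (i, j) ∈ pairs6 ∨ (i, j) ∈ pairsWith6 ↔ i < j ∧ j < 7 := by
  rw [← List.mem_append]
  refine ⟨fun h => ?_, fun ⟨hij, hj⟩ => ?_⟩
  · exact (by decide : ∀ e ∈ pairs6 ++ pairsWith6, e.1 < e.2 ∧ e.2 < 7) _ h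
  · exact (by decide : ∀ j < 7, ∀ i < j, (i, j) ∈ pairs6 ++ pairsWith6) j hj i hij

theorem checkAll_degree_four : checkAll (leafCheck [(3, 6), (0, 7), (4, 7), (5, 7)]) pairs6
    [(4, 6), (5, 6)] = true := by
  decide +kernel

theorem checkAll_degree_five : checkAll (leafCheck [(3, 6), (4, 6), (0, 7), (1, 7), (5, 7)]) pairs6
    [(5, 6)] = true := by
  decide +kernel

theorem edgeDegree_append_le (i : ℕ) (l₁ l₂ : List (ℕ × ℕ)) :
    edgeDegree i l₂ ≤ edgeDegree i (l₁ ++ l₂) :=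
  (List.sublist_append_right l₁ l₂).countP_le

theorem leaf_of_checkAll {leaf : List (ℕ × ℕ) → Bool} (p : ℕ × ℕ → Bool)
    (es l : List (ℕ × ℕ)) (hcheck : checkAll leaf es l = true)
    (hdeg : ∀ i, edgeDegree i ((es.filter p).reverse ++ l) ≤ 2) :
    leaf ((es.filter p).reverse ++ l) = true := by
  induction es generalizing l with
  | nil => simpa [checkAll] using hcheck
  | cons e es ih =>
    simp only [checkAll, Bool.and_eq_true, Bool.or_eq_true, Nat.blt_eq] at hcheck
    by_cases hp : p e = true
    · simp only [List.filter_cons_of_pos hp, List.reverse_cons, List.append_assoc,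
        List.singleton_append] at hdeg ⊢
      have h (i : ℕ) : edgeDegree i (e :: l) ≤ 2 :=
        (edgeDegree_append_le i _ _).trans (hdeg i)
      have h₁ := h e.1
      have h₂ := h e.2
      rcases hcheck.2 with (h' | h') | h'
      · omega
      · omega
      · exact ih _ h' hdeg
    · simp only [List.filter_cons_of_neg hp] at hdeg ⊢
      exact ih _ hcheck.1 hdeg

theorem testBit_edgeMask {l : List (ℕ × ℕ)} (hl : ∀ e ∈ l, e.1 < 8 ∧ e.2 < 8) {i j : ℕ}
    (hj : j < 8) :
    (edgeMask l).testBit (8 * i + j) = true ↔ (i, j) ∈ l ∨ (j, i) ∈ l := by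
  induction l with
  | nil => simp [edgeMask]
  | cons e l ih =>
    obtain ⟨a, b⟩ := e
    have hab := hl (a, b) (by simp)
    have ih := ih fun e he => hl e (List.mem_cons_of_mem _ he)
    simp only [edgeMask, Nat.testBit_or, Bool.or_eq_true, ih, Nat.testBit_two_pow,
      decide_eq_true_eq, List.mem_cons, Prod.mk.injEq]
    have h₁ : 8 * a + b = 8 * i + j ↔ i = a ∧ j = b := by omega
    have h₂ : 8 * b + a = 8 * i + j ↔ j = a ∧ i = b := by omega
    rw [h₁, h₂]
    grind

theorem exists_chain_of_hamPath {adj : ℕ → ℕ → Bool} {z : ℕ} (n x : ℕ) (r : List ℕ)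
    (h : hamPath adj z n x r = true) (hr : r.length = n) :
    ∃ l : List ℕ, l.Perm r ∧ List.IsChain (fun a b => adj a b = true) (x :: (l ++ [z])) := by
  induction n generalizing x r with
  | zero =>
    obtain rfl := List.length_eq_zero_iff.mp hr
    exact ⟨[], List.Perm.nil, by simpa [hamPath] using h⟩
  | succ n ih =>
    simp only [hamPath, List.any_eq_true, Bool.and_eq_true] at h
    obtain ⟨y, hy, hxy, h⟩ := h
    obtain ⟨l, hl, hc⟩ := ih y _ h (by rw [List.length_erase_of_mem hy]; omega)
    exact ⟨y :: l, (hl.cons y).trans (List.perm_cons_erase hy).symm,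
      List.IsChain.cons_cons hxy hc⟩

/-- An edge `pq` dominating a 6-cycle that avoids it yields a `W₆`-minor. -/
theorem wheel_six_isMinorOf {V : Type*} {G : SimpleGraph V} {p q : V} (c : ZMod 6 → V)
    (hc : Function.Injective c) (hp : ∀ i, c i ≠ p) (hq : ∀ i, c i ≠ q) (hpq : G.Adj p q)
    (hcycle : ∀ i, G.Adj (c i) (c (i + 1))) (hhub : ∀ i, G.Adj p (c i) ∨ G.Adj q (c i)) :
    (wheel 6).IsMinorOf G := by
  have hspoke (i : ZMod 6) : ∃ a ∈ ({p, q} : Set V), G.Adj a (c i) := by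
    rcases hhub i with h | h
    · exact ⟨p, by simp, h⟩
    · exact ⟨q, by simp, h⟩
  refine ⟨fun w => w.elim {p, q} fun i => {c i}, ?_, ?_, ?_, ?_⟩
  · rintro (_ | i) <;> simp
  · rintro (_ | i)
    · exact SimpleGraph.induce_pair_connected_of_adj hpq
    · have : Unique ({c i} : Set V) := Set.uniqueSingleton _
      exact (SimpleGraph.Connected.of_subsingleton : (G.induce {c i}).Connected)
  · rintro (_ | i) (_ | j) hij
    · exact absurd rfl hij
    · simp [hp, hq]
    · simp [hp, hq]
    · have : c i ≠ c j := fun h => hij (congrArg some (hc h))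
      simpa using this
  · rintro (_ | i) (_ | j) hij
    · exact absurd rfl hij.ne
    · obtain ⟨a, ha, h⟩ := hspoke j
      exact ⟨a, ha, c j, rfl, h⟩
    · obtain ⟨a, ha, h⟩ := hspoke i
      exact ⟨c i, rfl, a, ha, h.symm⟩
    · have : j = i + 1 ∨ i = j + 1 := by
        simpa [wheel] using (SimpleGraph.fromRel_adj _ _ _).mp hij |>.2
      refine ⟨c i, rfl, c j, rfl, ?_⟩
      rcases this with rfl | rfl
      · exact hcycle i
      · exact (hcycle j).symm

theorem isMinorOf_of_hasHubEdge {V : Type*} {G : SimpleGraph V} {adj : ℕ → ℕ → Bool}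
    (g : ℕ → V) (hg : ∀ i < 8, ∀ j < 8, g i = g j → i = j)
    (hadj : ∀ i < 8, ∀ j < 8, i ≠ j → adj i j = true → G.Adj (g i) (g j))
    (h : hasHubEdge adj = true) : (wheel 6).IsMinorOf G := by
  simp only [hasHubEdge, List.any_eq_true, Bool.and_eq_true] at h
  obtain ⟨⟨p, q⟩, hmem, hpq, h⟩ := h
  obtain ⟨hp, hq, hne, hlen⟩ := hubEdges_spec _ hmem
  have hr (i : ℕ) : i ∈ ((List.range 8).filter fun i => i != p && i != q) ↔
      i < 8 ∧ i ≠ p ∧ i ≠ q := by simp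
  have hnodup : ((List.range 8).filter fun i => i != p && i != q).Nodup :=
    List.nodup_range.filter _
  dsimp only at hp hq hne hlen hpq h
  generalize ((List.range 8).filter fun i => i != p && i != q) = s at *
  match s, h with
  | z :: r, h =>
    simp only [Bool.and_eq_true, List.all_eq_true, Bool.or_eq_true] at h
    obtain ⟨hhub, hham⟩ := h
    obtain ⟨l, hl, hchain⟩ := exists_chain_of_hamPath 5 z r hham (by simpa using hlen)
    have hperm : (z :: l).Perm (z :: r) := hl.cons z
    have hnd := hperm.nodup_iff.mpr hnodup
    have hlen' : (z :: l).length = 6 := hperm.length_eq.trans hlen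
    match l, hlen' with
    | [x₁, x₂, x₃, x₄, x₅], hlen' =>
      let c : ZMod 6 → ℕ := fun i => [z, x₁, x₂, x₃, x₄, x₅].get (Fin.cast hlen'.symm i)
      have hcmem (i : ZMod 6) : c i ∈ z :: r := hperm.subset (List.get_mem _ _)
      have hc (i : ZMod 6) : c i < 8 ∧ c i ≠ p ∧ c i ≠ q := (hr _).mp (hcmem i)
      have hcinj : Function.Injective c := fun i j hij =>
        Fin.cast_injective hlen'.symm (List.nodup_iff_injective_get.mp hnd hij)
      have hcycle (i : ZMod 6) : adj (c i) (c (i + 1)) = true := by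
        simp only [List.cons_append, List.nil_append, List.isChain_cons_cons] at hchain
        obtain ⟨h₀, h₁, h₂, h₃, h₄, h₅, -⟩ := hchain
        fin_cases i
        exacts [h₀, h₁, h₂, h₃, h₄, h₅]
      refine wheel_six_isMinorOf (p := g p) (q := g q) (g ∘ c) ?_ ?_ ?_ (hadj p hp q hq hne hpq)
        ?_ ?_
      · exact fun i j hij => hcinj (hg _ (hc i).1 _ (hc j).1 hij)
      · exact fun i hi => (hc i).2.1 (hg _ (hc i).1 _ hp hi)
      · exact fun i hi => (hc i).2.2 (hg _ (hc i).1 _ hq hi)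
      · refine fun i => hadj _ (hc i).1 _ (hc (i + 1)).1 (fun hi => ?_) (hcycle i)
        exact (by decide : ∀ i : ZMod 6, i ≠ i + 1) i (hcinj hi)
      · refine fun i => (hhub _ (hcmem i)).imp (hadj p hp _ (hc i).1 (hc i).2.1.symm)
          (hadj q hq _ (hc i).1 (hc i).2.2.symm)

/-- A graph on seven vertices with degrees four and five, not all four, whose complement has no
cycle of length four. -/
structure IsSplitBase {V : Type*} (G : SimpleGraph V) : Prop where
  card_eq : Nat.card V = 7
  degree_eq : ∀ v, (G.neighborSet v).ncard = 4 ∨ (G.neighborSet v).ncard = 5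
  exists_degree_eq_five : ∃ v, (G.neighborSet v).ncard = 5
  adj_of_four : ∀ a b c d, a ≠ b → a ≠ c → a ≠ d → b ≠ c → b ≠ d → c ≠ d →
    G.Adj a b ∨ G.Adj b c ∨ G.Adj c d ∨ G.Adj d a

open Classical in
/-- The nonadjacent pairs of `G` under the labelling `f` of its vertices by `0, …, 6`. -/
noncomputable def nonEdges {V : Type*} (G : SimpleGraph V) (f : ℕ → V) : List (ℕ × ℕ) :=
  (pairs6.filter fun e => ¬G.Adj (f e.1) (f e.2)).reverse ++
    pairsWith6.filter fun e => ¬G.Adj (f e.1) (f e.2)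

section Labelling

variable {V : Type*} {G : SimpleGraph V} {f : ℕ → V}

theorem mem_nonEdges {i j : ℕ} :
    (i, j) ∈ nonEdges G f ↔ (i < j ∧ j < 7) ∧ ¬G.Adj (f i) (f j) := by
  simp [nonEdges, ← mem_pairs_iff, or_and_right]

theorem edgeDegree_nonEdges_add (hinj : ∀ i < 7, ∀ j < 7, f i = f j → i = j)
    (hsurj : ∀ u, ∃ i < 7, f i = u) {i : ℕ} (hi : i < 7) :
    edgeDegree i (nonEdges G f) + (G.neighborSet (f i)).ncard = 6 := by
  classical
  have himage : G.neighborSet (f i) =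
      f '' ↑((Finset.range 7).filter fun j => G.Adj (f i) (f j)) := by
    ext u
    obtain ⟨j, hj, rfl⟩ := hsurj u
    simp only [SimpleGraph.mem_neighborSet, Set.mem_image, Finset.mem_coe, Finset.mem_filter,
      Finset.mem_range]
    exact ⟨fun h => ⟨j, ⟨hj, h⟩, rfl⟩, fun ⟨k, ⟨_, hk⟩, hkj⟩ => hkj ▸ hk⟩
  have hinj' : Set.InjOn f ↑((Finset.range 7).filter fun j => G.Adj (f i) (f j)) := by
    intro j hj k hk
    simp only [Finset.mem_coe, Finset.mem_filter, Finset.mem_range] at hj hk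
    exact hinj j hj.1 k hk.1
  rw [himage, hinj'.ncard_image, Set.ncard_coe_finset, Finset.card_filter]
  simp only [Finset.sum_range_succ, Finset.sum_range_zero, nonEdges, edgeDegree,
    List.countP_append, List.countP_reverse, List.countP_filter]
  clear himage hinj' hinj hsurj
  interval_cases i <;>
    simp [pairs6, pairsWith6, List.countP_cons] <;>
    grind [SimpleGraph.adj_comm]

theorem edgeDegree_nonEdges_of_le {i : ℕ} (hi : 7 ≤ i) : edgeDegree i (nonEdges G f) = 0 := by
  rw [edgeDegree, List.countP_eq_zero]
  rintro ⟨j, k⟩ h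
  have := (mem_nonEdges.mp h).1
  simp only [Bool.or_eq_true, beq_iff_eq]
  omega

open Classical in
theorem isMinorOf_splitGraph_of_checkAll (hG : IsSplitBase G)
    (hinj : ∀ i < 7, ∀ j < 7, f i = f j → i = j) (hsurj : ∀ u, ∃ i < 7, f i = u)
    {extra acc : List (ℕ × ℕ)} (hextra : ∀ e ∈ extra, e.1 < 6 ∧ 6 ≤ e.2 ∧ e.2 < 8)
    (hacc : pairsWith6.filter (fun e => ¬G.Adj (f e.1) (f e.2)) = acc)
    (hcheck : checkAll (leafCheck extra) pairs6 acc = true) {X Y : Set V}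
    (hX : ∀ i < 6, (i, 6) ∉ extra ++ acc → f i ∈ X) (hY : ∀ i < 6, (i, 7) ∉ extra → f i ∈ Y) :
    (wheel 6).IsMinorOf (splitGraph G (f 6) X Y) := by
  have hmem {i : ℕ} (hi : i < 6) : (i, 6) ∈ acc ↔ ¬G.Adj (f i) (f 6) := by
    have : (i, 6) ∈ pairsWith6 := by
      simp [pairsWith6]
      omega
    simp [← hacc, this]
  have hdeg {i : ℕ} (hi : i < 7) := edgeDegree_nonEdges_add (G := G) hinj hsurj hi
  have hdeg_le (i : ℕ) : edgeDegree i (nonEdges G f) ≤ 2 := by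
    rcases lt_or_ge i 7 with hi | hi
    · have := hdeg hi
      have := hG.degree_eq (f i)
      omega
    · simp [edgeDegree_nonEdges_of_le hi]
  have hnon : nonEdges G f = (pairs6.filter fun e => ¬G.Adj (f e.1) (f e.2)).reverse ++ acc := by
    rw [← hacc, nonEdges]
  have hleaf := leaf_of_checkAll (fun e => ¬G.Adj (f e.1) (f e.2)) pairs6 acc hcheck
    (by rw [← hnon]; exact hdeg_le)
  rw [← hnon] at hleaf
  simp only [leafCheck, Bool.or_eq_true, List.any_eq_true, List.all_eq_true, List.mem_range,
    beq_iff_eq, bne_iff_ne] at hleaf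
  have hlt (e : ℕ × ℕ) (he : e ∈ nonEdges G f) : e.1 < 8 ∧ e.2 < 8 := by
    have := (mem_nonEdges (i := e.1) (j := e.2)).mp he
    omega
  rcases hleaf with ((⟨i, hi, h0⟩ | hne) | hub) | hcycle
  · have := hdeg hi
    have := hG.degree_eq (f i)
    omega
  · obtain ⟨v, hv⟩ := hG.exists_degree_eq_five
    obtain ⟨i, hi, rfl⟩ := hsurj v
    have := hdeg hi
    exact absurd (by omega) (hne i hi)
  · have hne6 {i : ℕ} (hi : i < 6) : f i ≠ f 6 := fun h => by
      have := hinj i (by omega) 6 (by omega) h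
      omega
    let g : ℕ → {u : V // u ≠ f 6} ⊕ Fin 2 := fun i =>
      if hi : i < 6 then .inl ⟨f i, hne6 hi⟩ else if i = 6 then .inr 0 else .inr 1
    have hlt' (e : ℕ × ℕ) (he : e ∈ extra ++ nonEdges G f) : e.1 < 8 ∧ e.2 < 8 := by
      rcases List.mem_append.mp he with he | he
      · have := hextra e he
        omega
      · exact hlt e he
    have hadj (i j : ℕ) (hij : i < j) (hj : j < 8) (h : (i, j) ∉ extra ++ nonEdges G f) :
        (splitGraph G (f 6) X Y).Adj (g i) (g j) := by
      rw [List.mem_append, not_or, mem_nonEdges] at h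
      obtain hj | rfl | rfl : j < 6 ∨ j = 6 ∨ j = 7 := by omega
      · have hi : i < 6 := by omega
        have hA : G.Adj (f i) (f j) := by
          by_contra hA
          exact h.2 ⟨⟨hij, by omega⟩, hA⟩
        simpa [g, hi, hj, splitGraph, hA, hA.symm] using hA.ne
      · have hx : f i ∈ X := by
          refine hX i hij ?_
          rw [List.mem_append, not_or, hmem hij]
          exact ⟨h.1, fun hA => h.2 ⟨⟨hij, by omega⟩, hA⟩⟩
        simp [g, hij, splitGraph, hx]
      · obtain hi | rfl : i < 6 ∨ i = 6 := by omega
        · simp [g, hi, splitGraph, hY i hi h.1]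
        · simp [g, splitGraph]
    refine isMinorOf_of_hasHubEdge g ?_ ?_ hub
    · intro i hi j hj hij
      simp only [g] at hij
      split_ifs at hij
      all_goals simp at hij
      all_goals first | omega | exact hinj i (by omega) j (by omega) hij
    · intro i hi j hj hij h
      have h : ¬((i, j) ∈ extra ++ nonEdges G f ∨ (j, i) ∈ extra ++ nonEdges G f) := by
        rw [← testBit_edgeMask hlt' hj]
        simpa using h
      rw [not_or] at h
      rcases lt_or_gt_of_ne hij with hij | hij
      · exact hadj i j hij hj h.1
      · exact (hadj j i hij hi h.2).symm
  · simp only [hasFourCycle, List.any_eq_true, List.mem_range, Bool.and_eq_true,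
      bne_iff_ne] at hcycle
    obtain ⟨a, ha, b, hb, hab, c, hc, ⟨hac, hbc⟩, d, hd, ⟨hbd, hcd⟩, hda⟩ := hcycle
    have key {i j : ℕ} (hi : i < 7) (hj : j < 7)
        (h : (edgeMask (nonEdges G f)).testBit (8 * i + j) = true) :
        f i ≠ f j ∧ ¬G.Adj (f i) (f j) := by
      rw [testBit_edgeMask hlt (by omega), mem_nonEdges, mem_nonEdges, G.adj_comm (f j)] at h
      refine ⟨fun hf => ?_, by tauto⟩
      have := hinj i hi j hj hf
      omega
    have hab := key ha hb hab
    have hbc := key hb hc hbc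
    have hcd := key hc hd hcd
    have hda := key hd ha hda
    have := hG.adj_of_four (f a) (f b) (f c) (f d) hab.1 (fun h => hac (hinj a ha c hc h))
      hda.1.symm hbc.1 (fun h => hbd (hinj b hb d hd h)) hcd.1
    tauto

end Labelling

/-- A cover of `N` by two sets of size at least three refines to a partition into three parts with
prescribed sizes, of which the first two lie in `X` and the last two in `Y`. -/
theorem exists_three_parts {V : Type*} [DecidableEq V] {N X Y : Finset V} (hN : X ∪ Y = N)
    (hX : 3 ≤ X.card) (hY : 3 ≤ Y.card) (hle : N.card ≤ 6) :
    ∃ A B D : Finset V, Disjoint A B ∧ Disjoint A D ∧ Disjoint B D ∧ A ∪ B ∪ D = N ∧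
      A ∪ B ⊆ X ∧ B ∪ D ⊆ Y ∧ A.card = N.card - 3 ∧ B.card = 6 - N.card ∧
        D.card = N.card - 3 := by
  have hcard := Finset.card_union_add_card_inter X Y
  have hsdiff := Finset.card_sdiff_add_card X Y
  have hXN : X.card ≤ N.card := Finset.card_le_card (hN ▸ Finset.subset_union_left)
  rw [hN] at hcard hsdiff
  obtain ⟨B, hB, hBcard⟩ := Finset.exists_subset_card_eq (s := X ∩ Y) (n := 6 - N.card) (by omega)
  have hBX : B ⊆ X := hB.trans Finset.inter_subset_left
  have hBY : B ⊆ Y := hB.trans Finset.inter_subset_right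
  have hXB := Finset.card_sdiff_add_card_eq_card hBX
  obtain ⟨A, hA₁, hA₂, hAcard⟩ := Finset.exists_subsuperset_card_eq
    (Finset.sdiff_subset_sdiff (Finset.Subset.refl X) hBY) (n := N.card - 3)
    (by omega) (by omega)
  have hAB : Disjoint A B := Finset.disjoint_of_subset_left hA₂ Finset.sdiff_disjoint
  have hABX : A ∪ B ⊆ X := Finset.union_subset (hA₂.trans Finset.sdiff_subset) hBX
  have hABN : A ∪ B ⊆ N := hABX.trans (hN ▸ Finset.subset_union_left)
  have hD := Finset.card_sdiff_add_card_eq_card hABN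
  rw [Finset.card_union_of_disjoint hAB] at hD
  have hdisj : Disjoint (A ∪ B) (N \ (A ∪ B)) := Finset.disjoint_sdiff
  rw [Finset.disjoint_union_left] at hdisj
  refine ⟨A, B, N \ (A ∪ B), hAB, hdisj.1, hdisj.2, Finset.union_sdiff_of_subset hABN, hABX,
    Finset.union_subset hBY ?_, hAcard, hBcard, by omega⟩
  intro u hu
  by_contra huY
  simp only [← hN, Finset.mem_sdiff, Finset.mem_union, not_or] at hu
  exact hu.2.1 (hA₁ (Finset.mem_sdiff.mpr ⟨hu.1.resolve_right huY, huY⟩))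

theorem getD_labelling {V : Type*} [Finite V] {L : List V} {n : ℕ} (hL : L.Nodup)
    (hlen : L.length = n) (hcard : Nat.card V = n) (v : V) :
    (∀ i < n, ∀ j < n, L.getD i v = L.getD j v → i = j) ∧ ∀ u, ∃ i < n, L.getD i v = u := by
  classical
  subst hlen
  refine ⟨fun i hi j hj h => ?_, fun u => ?_⟩
  · rwa [List.getD_eq_getElem _ _ hi, List.getD_eq_getElem _ _ hj, hL.getElem_inj_iff] at h
  · have hu : u ∈ L := by
      have := Fintype.ofFinite V
      have h : L.toFinset = Finset.univ := by
        rw [← Finset.card_eq_iff_eq_univ, List.toFinset_card_of_nodup hL, ← hcard,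
          Nat.card_eq_fintype_card]
      simp [← List.mem_toFinset, h]
    obtain ⟨i, hi, rfl⟩ := List.getElem_of_mem hu
    exact ⟨i, hi, List.getD_eq_getElem _ _ hi⟩

theorem IsSplitBase.allSplitsHaveW6Minor {V : Type*} {G : SimpleGraph V} (hG : IsSplitBase G) :
    AllSplitsHaveW6Minor G := by
  classical
  rintro v X Y ⟨-, -, hXY, hX, hY⟩
  have : Finite V := Nat.finite_of_card_ne_zero (by rw [hG.card_eq]; decide)
  have := Fintype.ofFinite V
  have hcard := hG.card_eq
  rw [Nat.card_eq_fintype_card] at hcard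
  have hN : X.toFinset ∪ Y.toFinset = (G.neighborSet v).toFinset := by
    rw [← Set.toFinset_union]
    exact Set.toFinset_congr hXY
  have hdeg := hG.degree_eq v
  rw [Set.ncard_eq_toFinset_card'] at hX hY hdeg
  obtain ⟨A, B, D, hAB, hAD, hBD, hABD, hABX, hBDY, hA, hB, hD⟩ :=
    exists_three_parts hN hX hY (by omega)
  have hv : v ∉ (G.neighborSet v).toFinset := by simp
  have hC := Finset.card_compl (insert v (G.neighborSet v).toFinset)
  rw [Finset.card_insert_of_notMem hv, hcard] at hC
  have hadj (u : V) : G.Adj u v ↔ u ∈ A ∪ B ∪ D := by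
    rw [hABD, Set.mem_toFinset, SimpleGraph.mem_neighborSet, G.adj_comm]
  have hmem (u : V) : u ∈ (insert v (G.neighborSet v).toFinset)ᶜ ↔ u ≠ v ∧ ¬G.Adj u v := by
    simp [G.adj_comm]
  have hvv : ¬G.Adj v v := G.irrefl
  generalize (insert v (G.neighborSet v).toFinset)ᶜ = C at hC hmem
  rcases hdeg with hdeg | hdeg
  · rw [hdeg] at hA hB hC hD
    obtain ⟨a, rfl⟩ := Finset.card_eq_one.mp hA
    obtain ⟨b, c, hbc, rfl⟩ := Finset.card_eq_two.mp hB
    obtain ⟨d, rfl⟩ := Finset.card_eq_one.mp hD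
    obtain ⟨p, q, hpq, rfl⟩ := Finset.card_eq_two.mp hC
    simp only [Finset.mem_union, Finset.mem_insert, Finset.mem_singleton] at hadj hmem
    have hL : [a, b, c, d, p, q, v].Nodup := by
      have hp := (hmem p).mp (Or.inl rfl)
      have hq := (hmem q).mp (Or.inr rfl)
      rw [hadj] at hp hq hvv
      clear hN hX hY hABD hABX hBDY hadj hmem hv
      simp only [Finset.disjoint_singleton_left, Finset.disjoint_singleton_right,
        Finset.mem_insert, Finset.mem_singleton] at hAB hAD hBD
      simp only [List.nodup_cons, List.mem_cons, List.not_mem_nil, List.nodup_nil]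
      grind
    obtain ⟨hinj, hsurj⟩ := getD_labelling hL rfl hG.card_eq v
    refine isMinorOf_splitGraph_of_checkAll hG hinj hsurj (by decide) ?_ checkAll_degree_four ?_ ?_
    · have hp : ¬G.Adj p v := ((hmem p).mp (by simp)).2
      have hq : ¬G.Adj q v := ((hmem q).mp (by simp)).2
      simp [pairsWith6, hadj a, hadj b, hadj c, hadj d, hp, hq]
    · have : ∀ u ∈ ({a} ∪ {b, c} : Finset V), u ∈ X := fun u hu => by simpa using hABX hu
      intro i hi
      interval_cases i <;> simp [this]
    · have : ∀ u ∈ ({b, c} ∪ {d} : Finset V), u ∈ Y := fun u hu => by simpa using hBDY hu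
      intro i hi
      interval_cases i <;> simp [this]
  · rw [hdeg] at hA hB hC hD
    obtain ⟨a, b, hab, rfl⟩ := Finset.card_eq_two.mp hA
    obtain ⟨c, rfl⟩ := Finset.card_eq_one.mp hB
    obtain ⟨d, e, hde, rfl⟩ := Finset.card_eq_two.mp hD
    obtain ⟨p, rfl⟩ := Finset.card_eq_one.mp hC
    simp only [Finset.mem_union, Finset.mem_insert, Finset.mem_singleton] at hadj hmem
    have hL : [a, b, c, d, e, p, v].Nodup := by
      have hp := (hmem p).mp rfl
      rw [hadj] at hp hvv
      clear hN hX hY hABD hABX hBDY hadj hmem hv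
      simp only [Finset.disjoint_singleton_left, Finset.disjoint_singleton_right,
        Finset.disjoint_insert_left, Finset.mem_insert, Finset.mem_singleton] at hAB hAD hBD
      simp only [List.nodup_cons, List.mem_cons, List.not_mem_nil, List.nodup_nil]
      grind
    obtain ⟨hinj, hsurj⟩ := getD_labelling hL rfl hG.card_eq v
    refine isMinorOf_splitGraph_of_checkAll hG hinj hsurj (by decide) ?_ checkAll_degree_five ?_ ?_
    · have hp : ¬G.Adj p v := ((hmem p).mp (by simp)).2
      simp [pairsWith6, hadj a, hadj b, hadj c, hadj d, hadj e, hp]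
    · have : ∀ u ∈ ({a, b} ∪ {c} : Finset V), u ∈ X := fun u hu => by simpa using hABX hu
      intro i hi
      interval_cases i <;> simp [this]
    · have : ∀ u ∈ ({c} ∪ {d, e} : Finset V), u ∈ Y := fun u hu => by simpa using hBDY hu
      intro i hi
      interval_cases i <;> simp [this]

/-- In a 4-connected graph, at most three vertices do not separate `A` from its complement. -/
theorem FourConnected.exists_adj {V : Type*} {G : SimpleGraph V} (hG : FourConnected G)
    {S A : Set V} (hS : S.ncard ≤ 3) {a b : V} (ha : a ∈ A) (haS : a ∉ S) (hb : b ∉ A)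
    (hbS : b ∉ S) : ∃ x ∈ A, ∃ y ∉ A, x ∉ S ∧ y ∉ S ∧ G.Adj x y := by
  obtain ⟨w⟩ := (hG.2 S hS).preconnected ⟨a, haS⟩ ⟨b, hbS⟩
  obtain ⟨d, -, hfst, hsnd⟩ := w.exists_boundary_dart {u | (u : V) ∈ A} ha hb
  exact ⟨_, hfst, _, hsnd, d.fst.2, d.snd.2, d.adj⟩

theorem FourConnected.isSplitBase {V : Type*} {G : SimpleGraph V} (hG : FourConnected G)
    (hcard : Nat.card V = 7) (hmax : ∀ v, (G.neighborSet v).ncard ≤ 5)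
    (hfive : ∃ v, (G.neighborSet v).ncard = 5) : IsSplitBase G := by
  have : Finite V := Nat.finite_of_card_ne_zero (by rw [hcard]; decide)
  refine ⟨hcard, fun v => ?_, hfive, fun a b c d hab hac had hbc hbd hcd => ?_⟩
  · have hv := hmax v
    by_contra hne
    have hlt : (insert v (G.neighborSet v)).ncard < (Set.univ : Set V).ncard := by
      have := Set.ncard_insert_le v (G.neighborSet v)
      rw [Set.ncard_univ, hcard]
      omega
    obtain ⟨u, -, hu⟩ := Set.exists_mem_notMem_of_ncard_lt_ncard hlt
    rw [Set.mem_insert_iff, not_or] at hu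
    obtain ⟨x, rfl, y, -, -, hy, hxy⟩ := hG.exists_adj (S := G.neighborSet v) (by omega)
      (Set.mem_singleton v) (by simp) hu.1 hu.2
    exact hy hxy
  · have hfour : ({a, b, c, d} : Set V).ncard = 4 := by
      rw [Set.ncard_insert_of_notMem (by simp [hab, hac, had]),
        Set.ncard_insert_of_notMem (by simp [hbc, hbd]), Set.ncard_pair hcd]
    have hS := Set.ncard_add_ncard_compl ({a, b, c, d} : Set V)
    obtain ⟨x, hx, y, hy, -, hyS, hxy⟩ := hG.exists_adj (S := ({a, b, c, d} : Set V)ᶜ) (A := {a, c})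
      (a := a) (b := b) (by omega) (by simp) (by simp) (by simp [hab.symm, hbc]) (by simp)
    rw [Set.mem_compl_iff, not_not] at hyS
    simp only [Set.mem_insert_iff, Set.mem_singleton_iff, not_or] at hx hy hyS
    rcases hx with rfl | rfl <;> rcases hyS with rfl | rfl | rfl | rfl <;>
      simp_all [G.adj_comm]

theorem isSplitBase_of_decide {V : Type*} [Fintype V] [DecidableEq V] (G : SimpleGraph V)
    [DecidableRel G.Adj] (hcard : Fintype.card V = 7) (hdeg : ∀ v, G.degree v = 4 ∨ G.degree v = 5)
    (hfive : ∃ v, G.degree v = 5)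
    (hfour : ∀ a b c d, [a, b, c, d].Nodup → G.Adj a b ∨ G.Adj b c ∨ G.Adj c d ∨ G.Adj d a) :
    IsSplitBase G := by
  have hncard (v : V) : (G.neighborSet v).ncard = G.degree v := by
    rw [Set.ncard_eq_toFinset_card', ← SimpleGraph.neighborFinset_def,
      SimpleGraph.card_neighborFinset_eq_degree]
  refine ⟨by rwa [Nat.card_eq_fintype_card], by simpa only [hncard], by simpa only [hncard],
    fun a b c d hab hac had hbc hbd hcd => ?_⟩
  exact hfour a b c d (by simp [hab, hac, had, hbc, hbd, hcd])

instance : DecidableRel cycleSq7PlusE.Adj := by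
  intro i j
  unfold cycleSq7PlusE
  simp only [SimpleGraph.fromRel_adj]
  infer_instance

instance : DecidableRel (doubleWheel 5).Adj := by
  rintro (i | i) (j | j) <;> unfold doubleWheel <;> simp only [SimpleGraph.fromRel_adj] <;>
    infer_instance

instance : DecidableRel K43_30.Adj := by
  rintro (i | i) (j | j) <;> unfold K43_30 <;> simp only [SimpleGraph.fromRel_adj] <;>
    infer_instance

instance : DecidableRel K43_31.Adj := by
  rintro (i | i) (j | j) <;> unfold K43_31 <;> simp only [SimpleGraph.fromRel_adj] <;>
    infer_instance

instance : DecidableRel K43_40.Adj := by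
  rintro (i | i) (j | j) <;> unfold K43_40 <;> simp only [SimpleGraph.fromRel_adj] <;>
    infer_instance

instance : DecidableRel K43_41.Adj := by
  rintro (i | i) (j | j) <;> unfold K43_41 <;> simp only [SimpleGraph.fromRel_adj] <;>
    infer_instance

instance : DecidableRel Gamma1.Adj := by
  intro i j
  unfold Gamma1
  simp only [SimpleGraph.fromEdgeSet_adj, Set.mem_insert_iff, Set.mem_singleton_iff]
  infer_instance

theorem isSplitBase_cycleSq7PlusE : IsSplitBase cycleSq7PlusE := by
  apply isSplitBase_of_decide <;> decide +kernel

theorem isSplitBase_doubleWheel_five : IsSplitBase (doubleWheel 5) := by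
  apply isSplitBase_of_decide <;> decide +kernel

theorem isSplitBase_K43_30 : IsSplitBase K43_30 := by
  apply isSplitBase_of_decide <;> decide +kernel

theorem isSplitBase_K43_31 : IsSplitBase K43_31 := by
  apply isSplitBase_of_decide <;> decide +kernel

theorem isSplitBase_K43_40 : IsSplitBase K43_40 := by
  apply isSplitBase_of_decide <;> decide +kernel

theorem isSplitBase_K43_41 : IsSplitBase K43_41 := by
  apply isSplitBase_of_decide <;> decide +kernel

theorem isSplitBase_Gamma1 : IsSplitBase Gamma1 := by
  apply isSplitBase_of_decide <;> decide +kernel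

theorem stmt19 {V : Type*} (G : SimpleGraph V) (hG : FourConnected G)
    (hcard : Nat.card V = 7)
    (hmax : ∀ v : V, (G.neighborSet v).ncard ≤ 5)
    (htwo : ∃ a b : V, a ≠ b ∧ (G.neighborSet a).ncard = 5 ∧ (G.neighborSet b).ncard = 5) :
    AllSplitsHaveW6Minor G ∧
      (AllSplitsHaveW6Minor cycleSq7PlusE ∧ AllSplitsHaveW6Minor (doubleWheel 5) ∧
        AllSplitsHaveW6Minor K43_30 ∧ AllSplitsHaveW6Minor K43_31 ∧
        AllSplitsHaveW6Minor K43_40 ∧ AllSplitsHaveW6Minor Gamma1 ∧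
        AllSplitsHaveW6Minor K43_41) := by
  obtain ⟨a, -, -, ha, -⟩ := htwo
  exact ⟨(hG.isSplitBase hcard hmax ⟨a, ha⟩).allSplitsHaveW6Minor,
    isSplitBase_cycleSq7PlusE.allSplitsHaveW6Minor,
    isSplitBase_doubleWheel_five.allSplitsHaveW6Minor,
    isSplitBase_K43_30.allSplitsHaveW6Minor, isSplitBase_K43_31.allSplitsHaveW6Minor,
    isSplitBase_K43_40.allSplitsHaveW6Minor, isSplitBase_Gamma1.allSplitsHaveW6Minor,
    isSplitBase_K43_41.allSplitsHaveW6Minor⟩
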